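/- arXiv:2305.05332 — 5 statements merged into one kernel-verified Lean document; each statement's English description precedes it below -/
import Mathlib

section
/- Let N, P, K be integers with N ≥ 2, P ≥ 1 and 2P ≤ K. Then, working in the real numbers, (1 − (1/N)^K) / (1 − (1/N)^{⌊K/P⌋}) ≤ N/(N−1) ≤ 2, where ⌊K/P⌋ denotes the integer floor of K/P. -/
/-- Order-optimality of the baseline MM-PC scheme in the regime `2P ≤ K`:
the ratio between the MM-PIR upper bound and the baseline rate is at most
`N/(N-1) ≤ 2`.  Here `K / P` is integer (floor) division. -/
theorem stmt_0 (N P K : ℤ) (hN : 2 ≤ N) (hP : 1 ≤ P) (hPK : 2 * P ≤ K) :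
    (1 - (1 / (N : ℝ)) ^ K) / (1 - (1 / (N : ℝ)) ^ (K / P)) ≤ (N : ℝ) / ((N : ℝ) - 1) ∧
      (N : ℝ) / ((N : ℝ) - 1) ≤ 2 := by
  have hN' : (2 : ℝ) ≤ N := by exact_mod_cast hN
  have hN0 : (0 : ℝ) < N := by linarith
  have hN1 : (0 : ℝ) < N - 1 := by linarith
  refine ⟨?_, by rw [div_le_iff₀ hN1]; linarith⟩
  have hx0 : 0 < 1 / (N : ℝ) := by positivity
  have hx1 : 1 / (N : ℝ) < 1 := by rw [div_lt_one hN0]; linarith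
  have hfloor : 1 ≤ K / P := by
    rw [Int.le_ediv_iff_mul_le (by linarith)]
    linarith
  have hpow : (1 / (N : ℝ)) ^ (K / P) ≤ 1 / (N : ℝ) := by
    simpa only [zpow_one] using zpow_le_zpow_right_of_le_one₀ hx0 hx1.le hfloor
  have hK : 0 < (1 / (N : ℝ)) ^ K := zpow_pos hx0 K
  calc (1 - (1 / (N : ℝ)) ^ K) / (1 - (1 / (N : ℝ)) ^ (K / P))
      ≤ 1 / (1 - 1 / (N : ℝ)) :=
        div_le_div₀ zero_le_one (by linarith) (by linarith) (by linarith)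
    _ = (N : ℝ) / ((N : ℝ) - 1) := by field_simp
end

section
/- Let N, M, P be integers with N ≥ 2, P ≥ 1 and M ≥ P. Define rational numbers α_i for i ≥ 1 by the backward recursion: α_i = 0 for every i ≥ M − P + 2; α_{M−P+1} = (N−1)^{M−P}; and α_i = (1/(N−1)) · Σ_{m=1}^{P} binom(P,m) · α_{i+m} for each i with 1 ≤ i ≤ M − P. Then for every i with 1 ≤ i ≤ M − P + 1, the rational number α_i is a positive integer, and moreover (N−1)^{i−1} divides α_i (i.e., α_i / (N−1)^{i−1} is an integer). -/
/-- A solution of the backward recursion `d * α_s = ∑_{m=1}^{P} C(P,m) α_{s+m}` for `s < n`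
(written with `α_s` at index `s + 1`) that starts from `α_n = d ^ n` and vanishes beyond `n`
is `d ^ s` times a natural number, which is positive for `s ≤ n`. -/
theorem exists_nat_eq_pow_mul_of_backward_recursion {d n P : ℕ} (hd : 0 < d) (hP : 1 ≤ P)
    {α : ℕ → ℚ} (hzero : ∀ i, n + 2 ≤ i → α i = 0) (htop : α (n + 1) = (d : ℚ) ^ n)
    (hrec : ∀ i, 1 ≤ i → i ≤ n →
      α i = (1 / (d : ℚ)) * ∑ m ∈ Finset.Icc 1 P, (P.choose m : ℚ) * α (i + m)) (s : ℕ) :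
    ∃ k : ℕ, (s ≤ n → 0 < k) ∧ α (s + 1) = (d : ℚ) ^ s * k := by
  induction h : n - s using Nat.strong_induction_on generalizing s with
  | _ t ih =>
    rcases lt_trichotomy s n with hs | rfl | hs
    · have step : ∀ m, ∃ k : ℕ, 1 ≤ m →
          (s + m ≤ n → 0 < k) ∧ α (s + m + 1) = (d : ℚ) ^ (s + m) * k := by
        intro m
        by_cases hm : 1 ≤ m
        · obtain ⟨k, hk⟩ := ih (n - (s + m)) (by omega) (s + m) rfl
          exact ⟨k, fun _ => hk⟩
        · exact ⟨0, fun h => absurd h hm⟩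
      choose k hk using step
      refine ⟨∑ m ∈ Finset.Icc 1 P, P.choose m * (d ^ (m - 1) * k m), fun _ => ?_, ?_⟩
      · refine Finset.sum_pos' (fun _ _ => Nat.zero_le _)
          ⟨1, Finset.mem_Icc.mpr ⟨le_rfl, hP⟩, ?_⟩
        have hk1 := (hk 1 le_rfl).1 hs
        have hc := Nat.choose_pos hP
        positivity
      · have hd' : (d : ℚ) ≠ 0 := by positivity
        rw [hrec (s + 1) (by omega) hs]
        push_cast
        rw [Finset.mul_sum, Finset.mul_sum]
        refine Finset.sum_congr rfl fun m hm => ?_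
        obtain ⟨r, rfl⟩ := Nat.exists_eq_add_of_le' (Finset.mem_Icc.mp hm).1
        rw [add_right_comm s 1, (hk (r + 1) (by omega)).2, Nat.add_sub_cancel]
        field_simp
        ring
    · exact ⟨1, fun _ => one_pos, by simpa using htop⟩
    · exact ⟨0, fun hle => absurd hle (by omega), by simpa using hzero (s + 1) (by omega)⟩


/-- The numbers of stages `α_i` of the proposed MM-PC scheme, defined by the
backward recursion `α_i = 0` for `i ≥ M-P+2`, `α_{M-P+1} = (N-1)^{M-P}` and
`α_i = (1/(N-1)) ∑_{m=1}^{P} C(P,m) α_{i+m}` for `1 ≤ i ≤ M-P`, are positive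
integers divisible by `(N-1)^{i-1}`. -/
theorem stmt_3 (N M P : ℕ) (hN : 2 ≤ N) (hP : 1 ≤ P) (hMP : P ≤ M)
    (α : ℕ → ℚ)
    (hzero : ∀ i, M - P + 2 ≤ i → α i = 0)
    (htop : α (M - P + 1) = ((N : ℚ) - 1) ^ (M - P))
    (hrec : ∀ i, 1 ≤ i → i ≤ M - P →
      α i = (1 / ((N : ℚ) - 1)) * ∑ m ∈ Finset.Icc 1 P, (P.choose m : ℚ) * α (i + m)) :
    ∀ i, 1 ≤ i → i ≤ M - P + 1 →
      ∃ a : ℤ, 0 < a ∧ α i = (a : ℚ) ∧ ((N : ℤ) - 1) ^ (i - 1) ∣ a := by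
  obtain ⟨d, rfl⟩ : ∃ d, N = d + 1 := ⟨N - 1, by omega⟩
  simp only [Nat.cast_add, Nat.cast_one, add_sub_cancel_right] at htop hrec ⊢
  have hd : 0 < d := by omega
  intro i hi hin
  obtain ⟨s, rfl⟩ := Nat.exists_eq_add_of_le' hi
  obtain ⟨k, hk, hα⟩ := exists_nat_eq_pow_mul_of_backward_recursion hd hP hzero htop hrec s
  have hkpos := hk (by omega)
  exact ⟨(d : ℤ) ^ s * k, by positivity, by simpa using hα, by simp⟩
end

section
/- Fix a field F and natural numbers M, K, t with 1 ≤ K ≤ M and t + 1 ≤ M. For each m ∈ {1,…,M} let B_m be a function assigning to every t-element subset T of {1,…,M} a value B_m(T) ∈ F. Assume there are coefficients c_{m,k} ∈ F (for m ∈ {K+1,…,M} and k ∈ {1,…,K}) such that B_m(T) = Σ_{k=1}^{K} c_{m,k} · B_k(T) for every m ∈ {K+1,…,M} and every t-element subset T of {1,…,M}. For each (t+1)-element subset S of {1,…,M}, list the leaders of S (the elements of S ∩ {1,…,K}) in increasing order as ℓ_1 < … < ℓ_p and the non-leaders of S (the elements of S \ {1,…,K}) in increasing order as n_1 < … < n_r,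 and define the structure-minus multicast message X_S = Σ_{a=1}^{p} (−1)^{a−1} · B_{ℓ_a}(S \ {ℓ_a}) − Σ_{b=1}^{r} (−1)^{b−1} · B_{n_b}(S \ {n_b}) ∈ F^{?}, i.e., as an element of the F-vector space of F-valued functions... (concretely, X_S is the indicated element of F obtained from the values B_m(·)). Then: for every (t+1)-element subset S of {1,…,M} with S ∩ {1,…,K} = ∅, the vector of values (X_S), viewed as an element of F, satisfies X_S ∈ span_F { X_A : A a (t+1)-element subset of {1,…,M} with A ∩ {1,…,K} ≠ ∅ }, where the span is taken inside F regarded as the ambient vector space containing all the scalars X_A; equivalently, there exist coefficients β_A ∈ F such that X_S = Σ_{A : A ∩ {1,…,K} ≠ ∅} β_A · X_A, where these coefficients can be chosen uniformly, i.e., depending only on M, K, t, S and the coefficient matrix (c_{m,k}) but not on the values of B_1,…,B_K: for all choices of the functions B_1,…,B_K the same coefficients β_A verify the identity. -/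
/-- The structure-minus multicast message `X_S`: the alternating-sign sum of
the subpackets of the leader messages (indices in `{1,…,K}`) of `S` minus the
alternating-sign sum of the subpackets of the non-leader messages of `S`,
where signs alternate in increasing order of the message index (the sign of a
symbol is `(-1)^(number of strictly smaller messages of the same kind in S)`). -/
def structureMinusQuery {F : Type*} [Field F] (K : ℕ) (B : ℕ → Finset ℕ → F)
    (S : Finset ℕ) : F :=
  (∑ x ∈ S ∩ Finset.Icc 1 K,
      (-1 : F) ^ ((S ∩ Finset.Icc 1 K).filter (fun y => y < x)).card * B x (S.erase x)) -
    ∑ x ∈ S \ Finset.Icc 1 K,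
      (-1 : F) ^ ((S \ Finset.Icc 1 K).filter (fun y => y < x)).card * B x (S.erase x)

section SignedOperators

variable {α R : Type*} [CommRing R]

/-- The accumulated sign of `x` relative to the members of `A`. -/
def signProd (σ : α → α → R) (A : Finset α) (x : α) : R := ∏ y ∈ A, σ y x

lemma signProd_mul_self {σ : α → α → R} {A : Finset α} {x : α}
    (hσ : ∀ x y, σ x y * σ x y = 1) :
    signProd σ A x * signProd σ A x = 1 := by
  simp [signProd, ← Finset.prod_mul_distrib, hσ]

lemma end_ext {f g : Module.End R (Finset α →₀ R)}
    (h : ∀ A, f (Finsupp.single A 1) = g (Finsupp.single A 1)) : f = g :=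
  Finsupp.lhom_ext' fun A => LinearMap.ext_ring (h A)

variable [DecidableEq α]

/-- Signed removal of `x` on the free module on finite sets. -/
noncomputable def lower (σ : α → α → R) (x : α) : Module.End R (Finset α →₀ R) :=
  Finsupp.linearCombination R fun A =>
    if x ∈ A then signProd σ A x • Finsupp.single (A.erase x) (1 : R) else 0

/-- Signed insertion of `x` on the free module on finite sets. -/
noncomputable def raise (σ : α → α → R) (x : α) : Module.End R (Finset α →₀ R) :=
  Finsupp.linearCombination R fun A =>
    if x ∈ A then 0 else signProd σ A x • Finsupp.single (insert x A) (1 : R)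

variable {σ : α → α → R} {x y : α} {A : Finset α}

lemma lower_single_of_mem (h : x ∈ A) :
    lower σ x (Finsupp.single A 1) = signProd σ A x • Finsupp.single (A.erase x) 1 := by
  simp [lower, h]

lemma lower_single_of_notMem (h : x ∉ A) : lower σ x (Finsupp.single A 1) = 0 := by
  simp [lower, h]

lemma raise_single_of_mem (h : x ∈ A) : raise σ x (Finsupp.single A 1) = 0 := by
  simp [raise, h]

lemma raise_single_of_notMem (h : x ∉ A) :
    raise σ x (Finsupp.single A 1) = signProd σ A x • Finsupp.single (insert x A) 1 := by
  simp [raise, h]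

lemma signProd_insert (h : y ∉ A) : signProd σ (insert y A) x = σ y x * signProd σ A x :=
  Finset.prod_insert h

lemma signProd_erase (hσ : ∀ x y, σ x y * σ x y = 1) (h : y ∈ A) :
    signProd σ (A.erase y) x = σ y x * signProd σ A x := by
  rw [signProd, signProd, ← Finset.mul_prod_erase A _ h, ← mul_assoc, hσ, one_mul]

lemma lower_mul_self : lower σ x * lower σ x = 0 := by
  refine end_ext fun A => ?_
  by_cases h : x ∈ A
  · simp [-Finsupp.smul_single, lower_single_of_mem h, lower_single_of_notMem]
  · simp [-Finsupp.smul_single, lower_single_of_notMem h]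

lemma lower_mul_lower (hσ : ∀ x y, σ x y * σ x y = 1) (hxy : x ≠ y) :
    lower σ x * lower σ y = (σ x y * σ y x) • (lower σ y * lower σ x) := by
  refine end_ext fun A => ?_
  by_cases hx : x ∈ A <;> by_cases hy : y ∈ A
  · have hx' : x ∈ A.erase y := by simp [hx, hxy]
    have hy' : y ∈ A.erase x := by simp [hy, hxy.symm]
    simp only [Module.End.mul_apply, LinearMap.smul_apply, lower_single_of_mem hx,
      lower_single_of_mem hy, map_smul, lower_single_of_mem hx', lower_single_of_mem hy',
      signProd_erase hσ hx, signProd_erase hσ hy, smul_smul, Finset.erase_right_comm (a := x)]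
    congr 1
    linear_combination (-signProd σ A x * signProd σ A y * σ y x) * hσ x y
  · have hy' : y ∉ A.erase x := by simp [hy]
    simp [-Finsupp.smul_single, lower_single_of_mem hx, lower_single_of_notMem hy,
      lower_single_of_notMem hy']
  · have hx' : x ∉ A.erase y := by simp [hx]
    simp [-Finsupp.smul_single, lower_single_of_mem hy, lower_single_of_notMem hx,
      lower_single_of_notMem hx']
  · simp [-Finsupp.smul_single, lower_single_of_notMem hx, lower_single_of_notMem hy]

lemma lower_mul_raise (hσ : ∀ x y, σ x y * σ x y = 1) (hxy : x ≠ y) :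
    lower σ x * raise σ y = (σ x y * σ y x) • (raise σ y * lower σ x) := by
  refine end_ext fun A => ?_
  by_cases hx : x ∈ A <;> by_cases hy : y ∈ A
  · have hy' : y ∈ A.erase x := by simp [hy, hxy.symm]
    simp [-Finsupp.smul_single, lower_single_of_mem hx, raise_single_of_mem hy,
      raise_single_of_mem hy']
  · have hx' : x ∈ insert y A := by simp [hx]
    have hy' : y ∉ A.erase x := by simp [hy]
    simp only [Module.End.mul_apply, LinearMap.smul_apply, lower_single_of_mem hx,
      raise_single_of_notMem hy, map_smul, lower_single_of_mem hx', raise_single_of_notMem hy',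
      signProd_erase hσ hx, signProd_insert hy, smul_smul,
      Finset.erase_insert_of_ne hxy.symm]
    congr 1
    linear_combination (-signProd σ A x * signProd σ A y * σ y x) * hσ x y
  · simp [-Finsupp.smul_single, lower_single_of_notMem hx, raise_single_of_mem hy]
  · have hx' : x ∉ insert y A := by simp [hx, hxy]
    simp [-Finsupp.smul_single, lower_single_of_notMem hx, raise_single_of_notMem hy,
      lower_single_of_notMem hx']

lemma lower_mul_lower_of_neg (hσ : ∀ x y, σ x y * σ x y = 1) (hxy : x ≠ y)
    (h : σ x y * σ y x = -1) : lower σ x * lower σ y = -(lower σ y * lower σ x) := by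
  rw [lower_mul_lower hσ hxy, h]
  module

lemma lower_mul_raise_of_neg (hσ : ∀ x y, σ x y * σ x y = 1) (hxy : x ≠ y)
    (h : σ x y * σ y x = -1) : lower σ x * raise σ y = -(raise σ y * lower σ x) := by
  rw [lower_mul_raise hσ hxy, h]
  module

lemma lower_mul_raise_self (hσ : ∀ x y, σ x y * σ x y = 1) (hx : σ x x = 1) :
    lower σ x * raise σ x + raise σ x * lower σ x = 1 := by
  refine end_ext fun A => ?_
  by_cases h : x ∈ A
  · simp [-Finsupp.smul_single, lower_single_of_mem h, raise_single_of_mem h,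
      raise_single_of_notMem, signProd_erase hσ h, hx, smul_smul, signProd_mul_self hσ, Finset.insert_erase h]
  · simp [-Finsupp.smul_single, lower_single_of_notMem h, raise_single_of_notMem h,
      lower_single_of_mem, signProd_insert h, hx, smul_smul, signProd_mul_self hσ, Finset.erase_insert h]

end SignedOperators

section AnticommutingSums

variable {ι E : Type*} [Ring E]

lemma sum_smul_mul_self_eq_zero {R : Type*} [CommRing R] [Algebra R E] (s : Finset ι)
    (c : ι → R) (d : ι → E) (hsq : ∀ i, d i * d i = 0)
    (hanti : ∀ i ∈ s, ∀ j ∈ s, i ≠ j → d i * d j = -(d j * d i)) :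
    (∑ i ∈ s, c i • d i) * (∑ i ∈ s, c i • d i) = 0 := by
  classical
  induction s using Finset.induction_on with
  | empty => simp
  | insert a s ha ih =>
    have h0 := ih fun i hi j hj => hanti i (Finset.mem_insert_of_mem hi) j
      (Finset.mem_insert_of_mem hj)
    have h1 : d a * (∑ i ∈ s, c i • d i) = -((∑ i ∈ s, c i • d i) * d a) := by
      rw [Finset.mul_sum, Finset.sum_mul, ← Finset.sum_neg_distrib]
      refine Finset.sum_congr rfl fun i hi => ?_
      rw [mul_smul_comm, smul_mul_assoc, ← smul_neg,
        hanti a (Finset.mem_insert_self a s) i (Finset.mem_insert_of_mem hi)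
          (by rintro rfl; exact ha hi)]
    rw [Finset.sum_insert ha, add_mul, mul_add, mul_add, h0, smul_mul_smul_comm, hsq,
      smul_mul_assoc, h1, mul_smul_comm]
    simp

lemma sum_smul_mul_sum_smul {R : Type*} [CommRing R] [Algebra R E] (s : Finset ι)
    (b c : ι → R) (d : ι → E) (hsq : ∀ i, d i * d i = 0)
    (hanti : ∀ i ∈ s, ∀ j ∈ s, i ≠ j → d i * d j = -(d j * d i)) :
    (∑ i ∈ s, b i • d i) * (∑ i ∈ s, c i • d i) =
      -((∑ i ∈ s, c i • d i) * (∑ i ∈ s, b i • d i)) := by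
  have h := sum_smul_mul_self_eq_zero s (b + c) d hsq hanti
  simp only [Pi.add_apply, add_smul, Finset.sum_add_distrib, add_mul, mul_add,
    sum_smul_mul_self_eq_zero s _ d hsq hanti, zero_add, add_zero] at h
  exact eq_neg_of_add_eq_zero_right h

end AnticommutingSums

/-- If the `d k`, `e k` satisfy the fermionic relations and commute with the anticommuting `δ k`,
then a vector killed by all `d k` can be corrected by elements of `W'` to one killed by all
`d k - δ k`. -/
lemma exists_correction {ι R V : Type*} [CommRing R] [AddCommGroup V] [Module R V]
    (L : Finset ι) (d e δ : ι → Module.End R V)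
    (hde : ∀ j ∈ L, d j * e j + e j * d j = 1)
    (hde' : ∀ k ∈ L, ∀ j ∈ L, k ≠ j → d k * e j = -(e j * d k))
    (hdδ : ∀ k ∈ L, ∀ j, d k * δ j = δ j * d k)
    (heδ : ∀ k ∈ L, ∀ j, δ j * e k = e k * δ j)
    (hδ : ∀ j, δ j * δ j = 0) (hδ' : ∀ k j, δ k * δ j = -(δ j * δ k))
    (W W' : Submodule R V) (hW : W' ≤ W) (hmaps : ∀ j ∈ L, ∀ v ∈ W, e j (δ j v) ∈ W')
    (v : V) (hv : v ∈ W) (hdv : ∀ k ∈ L, d k v = 0) :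
    ∃ w ∈ W', ∀ k ∈ L, (d k - δ k) (v + w) = 0 := by
  classical
  suffices h : ∀ J ⊆ L, ∃ w ∈ W', (∀ k ∈ J, (d k - δ k) (v + w) = 0) ∧
      ∀ k ∈ L, k ∉ J → d k (v + w) = 0 by
    obtain ⟨w, hw, h, -⟩ := h L subset_rfl
    exact ⟨w, hw, h⟩
  intro J
  induction J using Finset.induction_on with
  | empty => exact fun _ => ⟨0, W'.zero_mem, by simp, by simpa using hdv⟩
  | insert j J hj ih =>
    intro hJ
    have hjL : j ∈ L := hJ (Finset.mem_insert_self j J)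
    obtain ⟨w, hw, hD, hd⟩ := ih ((Finset.subset_insert j J).trans hJ)
    have hd_step : ∀ k ∈ L, k ≠ j →
        d k * (1 + e j * δ j) = (1 - e j * δ j) * d k := fun k hk hkj => by
      rw [mul_add, mul_one, ← mul_assoc, hde' k hk j hjL hkj, neg_mul, mul_assoc, hdδ k hk,
        sub_mul, one_mul, mul_assoc, sub_eq_add_neg]
    have hδ_step : ∀ k, δ k * (1 + e j * δ j) = (1 - e j * δ j) * δ k := fun k => by
      rw [mul_add, mul_one, ← mul_assoc, heδ j hjL, mul_assoc, hδ' k, sub_mul, one_mul,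
        mul_assoc, mul_neg, sub_eq_add_neg]
    have hself : (d j - δ j) * (1 + e j * δ j) = (1 - e j * δ j) * d j := by
      rw [sub_mul, hδ_step, mul_add, mul_one, ← mul_assoc, eq_sub_of_add_eq (hde j hjL),
        sub_mul, sub_mul, sub_mul, mul_assoc _ (d j), hdδ j hjL, mul_assoc _ (δ j) (δ j), hδ]
      simp only [one_mul, mul_zero, mul_assoc]
      abel
    have hvw : v + (w + e j (δ j (v + w))) = (1 + e j * δ j) (v + w) := by
      simp [add_assoc]
    refine ⟨w + e j (δ j (v + w)),
      W'.add_mem hw (hmaps j hjL _ (W.add_mem hv (hW hw))), ?_, ?_⟩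
    · intro k hk
      rw [hvw, ← Module.End.mul_apply]
      rcases Finset.mem_insert.1 hk with rfl | hkJ
      · rw [hself, Module.End.mul_apply, hd k hjL hj, map_zero]
      · have hkj : k ≠ j := by rintro rfl; exact hj hkJ
        rw [sub_mul, hd_step k (hJ hk) hkj, hδ_step, ← mul_sub, Module.End.mul_apply,
          hD k hkJ, map_zero]
    · intro k hk hkJ
      rw [Finset.mem_insert, not_or] at hkJ
      rw [hvw, ← Module.End.mul_apply, hd_step k hk hkJ.1, Module.End.mul_apply,
        hd k hk hkJ.2, map_zero]

/-- The sign `-1` attached to a smaller message of the same kind. -/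
def kindSign (F : Type*) [Field F] (K : ℕ) (y x : ℕ) : F :=
  if (y ∈ Finset.Icc 1 K ↔ x ∈ Finset.Icc 1 K) ∧ y < x then -1 else 1

section KindSign

variable {F : Type*} [Field F] {K : ℕ}

lemma kindSign_mul_self (x y : ℕ) : kindSign F K x y * kindSign F K x y = 1 := by
  unfold kindSign; split_ifs <;> simp

lemma kindSign_self (x : ℕ) : kindSign F K x x = 1 := by simp [kindSign]

lemma kindSign_mul_swap_of_same {x y : ℕ} (hxy : x ≠ y)
    (h : x ∈ Finset.Icc 1 K ↔ y ∈ Finset.Icc 1 K) :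
    kindSign F K x y * kindSign F K y x = -1 := by
  rcases lt_or_gt_of_ne hxy with hlt | hlt <;> simp [kindSign, -Finset.mem_Icc, h, hlt, hlt.le]

lemma kindSign_mul_swap_of_mem_of_notMem {x y : ℕ} (hx : x ∈ Finset.Icc 1 K)
    (hy : y ∉ Finset.Icc 1 K) : kindSign F K x y * kindSign F K y x = 1 := by
  simp [kindSign, -Finset.mem_Icc, hx, hy]

lemma signProd_kindSign_of_mem {x : ℕ} (A : Finset ℕ) (hx : x ∈ Finset.Icc 1 K) :
    signProd (kindSign F K) A x =
      (-1) ^ ((A ∩ Finset.Icc 1 K).filter (fun y => y < x)).card := by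
  simp only [signProd, kindSign, hx, iff_true, Finset.prod_ite, Finset.prod_const, one_pow,
    mul_one]
  congr 2
  ext y
  simp [-Finset.mem_Icc, and_assoc]

lemma signProd_kindSign_of_notMem {x : ℕ} (A : Finset ℕ) (hx : x ∉ Finset.Icc 1 K) :
    signProd (kindSign F K) A x =
      (-1) ^ ((A \ Finset.Icc 1 K).filter (fun y => y < x)).card := by
  simp only [signProd, kindSign, hx, iff_false, Finset.prod_ite, Finset.prod_const, one_pow,
    mul_one]
  congr 2
  ext y
  simp [-Finset.mem_Icc, and_assoc]

lemma structureMinusQuery_eq_sum {M t : ℕ} (c : ℕ → ℕ → F)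
    (B : ℕ → Finset ℕ → F)
    (hB : ∀ m ∈ Finset.Icc (K + 1) M, ∀ T ⊆ Finset.Icc 1 M, T.card = t →
      B m T = ∑ k ∈ Finset.Icc 1 K, c m k * B k T)
    {A : Finset ℕ} (hA : A ⊆ Finset.Icc 1 M) (hcard : A.card = t + 1) :
    structureMinusQuery K B A = ∑ k ∈ Finset.Icc 1 K, Finsupp.linearCombination F (B k)
      ((lower (kindSign F K) k - ∑ n ∈ Finset.Icc (K + 1) M, c n k • lower (kindSign F K) n)
        (Finsupp.single A 1)) := by
  have hval : ∀ k x, Finsupp.linearCombination F (B k)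
      (lower (kindSign F K) x (Finsupp.single A 1)) =
        if x ∈ A then signProd (kindSign F K) A x * B k (A.erase x) else 0 := by
    intro k x
    by_cases h : x ∈ A
    · simp [-Finsupp.smul_single, lower_single_of_mem h, h]
    · simp [-Finsupp.smul_single, lower_single_of_notMem h, h]
  have hsdiff : A \ Finset.Icc 1 K = Finset.Icc (K + 1) M ∩ A := by
    ext x
    have := @hA x
    simp only [Finset.mem_sdiff, Finset.mem_inter, Finset.mem_Icc] at this ⊢
    grind
  simp only [LinearMap.sub_apply, LinearMap.sum_apply, LinearMap.smul_apply, map_sub, map_sum,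
    map_smul, hval, Finset.sum_sub_distrib, structureMinusQuery]
  congr 1
  · rw [Finset.inter_comm, ← Finset.sum_ite_mem, Finset.inter_comm]
    refine Finset.sum_congr rfl fun x hx => ?_
    rw [signProd_kindSign_of_mem A hx]
  · rw [Finset.sum_comm, Finset.sum_congr hsdiff fun _ _ => rfl, ← Finset.sum_ite_mem]
    refine Finset.sum_congr rfl fun x hx => ?_
    have hxL : x ∉ Finset.Icc 1 K := by
      simp only [Finset.mem_Icc] at hx ⊢; omega
    by_cases h : x ∈ A
    · simp only [h, if_true, ← signProd_kindSign_of_notMem A hxL]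
      rw [hB x hx _ ((Finset.erase_subset x A).trans hA)
        (by rw [Finset.card_erase_of_mem h, hcard, Nat.add_sub_cancel]), Finset.mul_sum]
      refine Finset.sum_congr rfl fun k _ => ?_
      rw [smul_eq_mul]; ring
    · simp [h]

end KindSign

lemma raise_sum_lower_mem_supported {α R : Type*} [DecidableEq α] [CommRing R]
    {σ : α → α → R} {U L N : Finset α} {t : ℕ} (c : α → R) {j : α} (hjU : j ∈ U) (hjL : j ∈ L)
    {v : Finset α →₀ R} (hv : v ∈ Finsupp.supported R R {A | A ⊆ U ∧ A.card = t + 1}) :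
    raise σ j ((∑ n ∈ N, c n • lower σ n) v) ∈
      Finsupp.supported R R {A | (A ⊆ U ∧ A.card = t + 1) ∧ (A ∩ L).Nonempty} := by
  rw [Finsupp.supported_eq_span_single] at hv
  induction hv using Submodule.span_induction with
  | zero => simp
  | add u w _ _ hu hw => rw [map_add, map_add]; exact Submodule.add_mem _ hu hw
  | smul a u _ hu => rw [map_smul, map_smul]; exact Submodule.smul_mem _ a hu
  | mem u hu =>
    obtain ⟨A, ⟨hAU, hAcard⟩, rfl⟩ := hu
    simp only [LinearMap.sum_apply, LinearMap.smul_apply, map_sum, map_smul]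
    refine Submodule.sum_mem _ fun n _ => Submodule.smul_mem _ _ ?_
    by_cases hn : n ∈ A
    · rw [lower_single_of_mem hn, map_smul]
      refine Submodule.smul_mem _ _ ?_
      by_cases hj : j ∈ A.erase n
      · simp [-Finsupp.smul_single, raise_single_of_mem hj]
      · rw [raise_single_of_notMem hj]
        refine Submodule.smul_mem _ _ (Finsupp.single_mem_supported R 1 ⟨⟨?_, ?_⟩, j, ?_⟩)
        · exact Finset.insert_subset hjU ((Finset.erase_subset n A).trans hAU)
        · rw [Finset.card_insert_of_notMem hj, Finset.card_erase_of_mem hn, hAcard,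
            Nat.add_sub_cancel]
        · simp [hjL]
    · simp [-Finsupp.smul_single, lower_single_of_notMem hn]

/-- Redundancy lemma, structure-minus version: every round-`(t+1)` query whose
message set `S` contains no independent (leader) message is a linear
combination of the queries whose message sets intersect the leaders, with
coefficients `β` independent of the actual message values `B`. -/
theorem stmt_4 (F : Type*) [Field F] (M K t : ℕ) (hK1 : 1 ≤ K) (hKM : K ≤ M)
    (htM : t + 1 ≤ M) (c : ℕ → ℕ → F) (S : Finset ℕ) (hS : S ⊆ Finset.Icc 1 M)
    (hScard : S.card = t + 1) (hSleaders : S ∩ Finset.Icc 1 K = ∅) :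
    ∃ β : Finset ℕ → F, ∀ B : ℕ → Finset ℕ → F,
      (∀ m ∈ Finset.Icc (K + 1) M, ∀ T ⊆ Finset.Icc 1 M, T.card = t →
        B m T = ∑ k ∈ Finset.Icc 1 K, c m k * B k T) →
      structureMinusQuery K B S =
        ∑ A ∈ ((Finset.Icc 1 M).powersetCard (t + 1)).filter
            (fun A => (A ∩ Finset.Icc 1 K).Nonempty),
          β A * structureMinusQuery K B A := by
  have hσ := kindSign_mul_self (F := F) (K := K)
  set d := lower (kindSign F K) with hd
  set e := raise (kindSign F K) with he
  set δ : ℕ → Module.End F (Finset ℕ →₀ F) :=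
    fun k => ∑ n ∈ Finset.Icc (K + 1) M, c n k • d n with hδ
  have hN : ∀ n ∈ Finset.Icc (K + 1) M, n ∉ Finset.Icc 1 K := by
    intro n hn; simp only [Finset.mem_Icc] at hn ⊢; omega
  have hne : ∀ k ∈ Finset.Icc 1 K, ∀ n ∈ Finset.Icc (K + 1) M, k ≠ n := by
    rintro k hk n hn rfl; exact hN k hn hk
  have hanti : ∀ m ∈ Finset.Icc (K + 1) M, ∀ n ∈ Finset.Icc (K + 1) M, m ≠ n →
      d m * d n = -(d n * d m) := fun m hm n hn hmn => by
    exact lower_mul_lower_of_neg hσ hmn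
      (kindSign_mul_swap_of_same hmn (by simp only [hN m hm, hN n hn]))
  obtain ⟨w, hw, hkill⟩ := exists_correction (Finset.Icc 1 K) d e δ
    (fun j _ => lower_mul_raise_self hσ (kindSign_self j))
    (fun k hk j hj hkj => by
      exact lower_mul_raise_of_neg hσ hkj
        (kindSign_mul_swap_of_same hkj (by simp only [hk, hj])))
    (fun k hk j => by
      simp only [hδ, Finset.mul_sum, Finset.sum_mul, mul_smul_comm, smul_mul_assoc]
      refine Finset.sum_congr rfl fun n hn => ?_
      rw [hd, lower_mul_lower hσ (hne k hk n hn),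
        kindSign_mul_swap_of_mem_of_notMem hk (hN n hn), one_smul])
    (fun k hk j => by
      simp only [hδ, Finset.mul_sum, Finset.sum_mul, mul_smul_comm, smul_mul_assoc]
      refine Finset.sum_congr rfl fun n hn => ?_
      rw [hd, he, lower_mul_raise hσ (hne k hk n hn).symm, mul_comm (kindSign F K n k),
        kindSign_mul_swap_of_mem_of_notMem hk (hN n hn), one_smul])
    (fun j => sum_smul_mul_self_eq_zero _ _ d (fun _ => lower_mul_self) hanti)
    (fun k j => sum_smul_mul_sum_smul _ _ _ d (fun _ => lower_mul_self) hanti)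
    (Finsupp.supported F F {A | A ⊆ Finset.Icc 1 M ∧ A.card = t + 1})
    (Finsupp.supported F F
      {A | (A ⊆ Finset.Icc 1 M ∧ A.card = t + 1) ∧ (A ∩ Finset.Icc 1 K).Nonempty})
    (Finsupp.supported_mono fun _ hA => hA.1)
    (fun j hj v hv => raise_sum_lower_mem_supported _
      (Finset.Icc_subset_Icc_right hKM hj) hj hv)
    (Finsupp.single S 1) (Finsupp.single_mem_supported F 1 ⟨hS, hScard⟩)
    (fun k hk => lower_single_of_notMem fun hkS => by
      have := Finset.mem_inter.2 ⟨hkS, hk⟩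
      simp [hSleaders] at this)
  refine ⟨fun A => -w A, fun B hB => ?_⟩
  set G := ((Finset.Icc 1 M).powersetCard (t + 1)).filter
    (fun A => (A ∩ Finset.Icc 1 K).Nonempty) with hG
  have hw_eq : w = ∑ A ∈ G, w A • Finsupp.single A 1 := by
    have hsupp : w.support ⊆ G := fun A hA => by
      have := (Finsupp.mem_supported F w).1 hw hA
      simpa [hG, Finset.mem_powersetCard] using this
    conv_lhs => rw [← Finsupp.sum_single w]
    rw [Finsupp.sum_of_support_subset _ hsupp _ (by simp)]
    simp
  have hzero : structureMinusQuery K B S + ∑ A ∈ G, w A * structureMinusQuery K B A = 0 := by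
    have hquery : ∑ A ∈ G, w A * structureMinusQuery K B A =
        ∑ k ∈ Finset.Icc 1 K, Finsupp.linearCombination F (B k) ((d k - δ k) w) := by
      conv_rhs => rw [hw_eq]
      simp only [map_sum, map_smul]
      rw [Finset.sum_comm]
      refine Finset.sum_congr rfl fun A hA => ?_
      obtain ⟨hAM, hAcard⟩ := Finset.mem_powersetCard.1 (Finset.mem_filter.1 hA).1
      rw [structureMinusQuery_eq_sum c B hB hAM hAcard, Finset.mul_sum]
      rfl
    rw [hquery, structureMinusQuery_eq_sum c B hB hS hScard, ← Finset.sum_add_distrib]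
    refine Finset.sum_eq_zero fun k hk => ?_
    rw [← map_add, ← map_add, hkill k hk, map_zero]
  rw [eq_neg_of_add_eq_zero_left hzero, ← Finset.sum_neg_distrib]
  exact Finset.sum_congr rfl fun A _ => (neg_mul _ _).symm
end

section
/- Fix a field F and natural numbers M, K, t with 1 ≤ K ≤ M and t + 1 ≤ M. For each m ∈ {1,…,M} let B_m be a function assigning to every t-element subset T of {1,…,M} a value B_m(T) ∈ F. Assume there are coefficients c_{m,k} ∈ F (for m ∈ {K+1,…,M} and k ∈ {1,…,K}) such that B_m(T) = Σ_{k=1}^{K} c_{m,k} · B_k(T) for every m ∈ {K+1,…,M} and every t-element subset T of {1,…,M}. For each (t+1)-element subset S of {1,…,M}, list the leaders of S (the elements of S ∩ {1,…,K}) in increasing order as ℓ_1 < … < ℓ_p and the non-leaders of S (the elements of S \ {1,…,K}) in increasing order as n_1 < … < n_r, and define the structure-plus multicast message Y_S = Σ_{a=1}^{p} (−1)^{a−1} · B_{ℓ_a}(S \ {ℓ_a}) + Σ_{b=1}^{r} (−1)^{b−1} · B_{n_b}(S \ {n_b}) ∈ F. Then for every (t+1)-element subset S of {1,…,M} with S ∩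 {1,…,K} = ∅, there exist coefficients β_A ∈ F, depending only on M, K, t, S and the coefficient matrix (c_{m,k}) but not on the values of B_1,…,B_K, such that Y_S = Σ_{A : A a (t+1)-subset of {1,…,M} with A ∩ {1,…,K} ≠ ∅} β_A · Y_A, identically for all choices of the functions B_1,…,B_K. -/
/-- The structure-plus multicast message `Y_S`: the alternating-sign sum of
the subpackets of the leader messages (indices in `{1,…,K}`) of `S` plus the
alternating-sign sum of the subpackets of the non-leader messages of `S`,
where signs alternate in increasing order of the message index (the sign of a
symbol is `(-1)^(number of strictly smaller messages of the same kind in S)`). -/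
def structurePlusQuery {F : Type*} [Field F] (K : ℕ) (B : ℕ → Finset ℕ → F)
    (S : Finset ℕ) : F :=
  (∑ x ∈ S ∩ Finset.Icc 1 K,
      (-1 : F) ^ ((S ∩ Finset.Icc 1 K).filter (fun y => y < x)).card * B x (S.erase x)) +
    ∑ x ∈ S \ Finset.Icc 1 K,
      (-1 : F) ^ ((S \ Finset.Icc 1 K).filter (fun y => y < x)).card * B x (S.erase x)

namespace Finset

variable {α : Type*} [LinearOrder α]

theorem card_filter_lt_orderEmbOfFin (A : Finset α) {n : ℕ} (h : A.card = n) (i : Fin n) :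
    (A.filter (fun y => y < A.orderEmbOfFin h i)).card = i := by
  have key : A.filter (fun y => y < A.orderEmbOfFin h i) =
      (Finset.Iio i).map (A.orderEmbOfFin h).toEmbedding := by
    ext y
    simp only [mem_filter, mem_map, mem_Iio]
    constructor
    · rintro ⟨hy, hj⟩
      obtain ⟨j, rfl⟩ : y ∈ Set.range (A.orderEmbOfFin h) := by simpa using hy
      exact ⟨j, (A.orderEmbOfFin h).lt_iff_lt.1 hj, rfl⟩
    · rintro ⟨j, hj, rfl⟩
      exact ⟨A.orderEmbOfFin_mem h j, (A.orderEmbOfFin h).lt_iff_lt.2 hj⟩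
  rw [key, card_map, Fin.card_Iio]

theorem sum_orderEmbOfFin {N : Type*} [AddCommMonoid N] (A : Finset α) {n : ℕ}
    (h : A.card = n) (g : α → N) : ∑ i, g (A.orderEmbOfFin h i) = ∑ x ∈ A, g x := by
  conv_rhs => rw [← A.map_orderEmbOfFin_univ h, sum_map]
  rfl

theorem orderEmbOfFin_succAbove (A : Finset α) {n : ℕ} (h : A.card = n + 1) (i : Fin (n + 1))
    (h' : (A.erase (A.orderEmbOfFin h i)).card = n) (j : Fin n) :
    A.orderEmbOfFin h (i.succAbove j) = (A.erase (A.orderEmbOfFin h i)).orderEmbOfFin h' j := by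
  refine congrFun (orderEmbOfFin_unique h' (f := fun j => A.orderEmbOfFin h (i.succAbove j))
    (fun j => ?_) ?_) j
  · exact mem_erase.2 ⟨fun e => Fin.succAbove_ne i j ((A.orderEmbOfFin h).injective e),
      orderEmbOfFin_mem _ _ _⟩
  · exact (A.orderEmbOfFin h).strictMono.comp (Fin.strictMono_succAbove i)

/-- An injective tuple is a permutation of the increasing enumeration of its range. -/
theorem exists_perm_orderEmbOfFin_image {n : ℕ} {r : Fin n → α} (hr : Function.Injective r)
    (h : (univ.image r).card = n) :
    ∃ σ : Equiv.Perm (Fin n), ∀ i, r i = (univ.image r).orderEmbOfFin h (σ i) := by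
  let f : Fin n → Fin n := fun i =>
    ((univ.image r).orderIsoOfFin h).symm ⟨r i, mem_image_of_mem r (mem_univ i)⟩
  have hf : Function.Injective f := fun i j hij =>
    hr (congrArg Subtype.val (((univ.image r).orderIsoOfFin h).symm.injective hij))
  refine ⟨Equiv.ofBijective f (Finite.injective_iff_bijective.1 hf), fun i => ?_⟩
  simp [f, ← coe_orderIsoOfFin_apply]

end Finset

namespace AlternatingMap

variable {α R N : Type*} [LinearOrder α] [CommRing R] [AddCommGroup N] [Module R N]

/-- The minor of an `n`-tuple of vectors on the coordinates in `T`. -/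
noncomputable def minor (R : Type*) [CommRing R] {n : ℕ} (T : Finset α) (h : T.card = n) :
    (α → R) [⋀^Fin n]→ₗ[R] R :=
  Matrix.detRowAlternating.compLinearMap (LinearMap.funLeft R R (T.orderEmbOfFin h))

theorem minor_single {n : ℕ} (T T' : Finset α) (h : T.card = n) (h' : T'.card = n) :
    minor R T h (fun j => Pi.single (T'.orderEmbOfFin h' j) 1) = if T = T' then 1 else 0 := by
  have key : minor R T h (fun j => Pi.single (T'.orderEmbOfFin h' j) 1) =
      Matrix.det (Matrix.of fun i j : Fin n =>
        (Pi.single (T'.orderEmbOfFin h' i) 1 : α → R) (T.orderEmbOfFin h j)) := rfl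
  rw [key]
  split_ifs with hT
  · subst hT
    convert Matrix.det_one (n := Fin n) (R := R)
    ext i j
    simp [Pi.single_apply, Matrix.one_apply, eq_comm]
  · obtain ⟨x, hx, hxT⟩ : ∃ x ∈ T', x ∉ T := by
      by_contra! hsub
      exact hT (Finset.eq_of_subset_of_card_le hsub (by omega)).symm
    obtain ⟨i, rfl⟩ : x ∈ Set.range (T'.orderEmbOfFin h') := by simpa using hx
    refine Matrix.det_eq_zero_of_row_eq_zero i fun j => ?_
    have : T.orderEmbOfFin h j ≠ T'.orderEmbOfFin h' i := fun e =>
      hxT (e ▸ T.orderEmbOfFin_mem h j)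
    simp [this]

/-- The alternating-map-valued linear map which sends the basis vector of `x ∈ U` and the increasing
tuple of basis vectors of an `n`-subset `T` of `U` to `b x T`. -/
noncomputable def ofSubsets (R : Type*) [CommRing R] [Module R N] (U : Finset α) (n : ℕ)
    (b : α → Finset α → N) : (α → R) →ₗ[R] (α → R) [⋀^Fin n]→ₗ[R] N :=
  ∑ x ∈ U, (LinearMap.proj x : (α → R) →ₗ[R] R).smulRight
    (∑ T ∈ (U.powersetCard n).attach, (LinearMap.toSpanSingleton R N (b x T)).compAlternatingMap
      (minor R T.1 (Finset.mem_powersetCard.1 T.2).2))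

theorem finset_sum_apply {ι κ V : Type*} [AddCommGroup V] [Module R V] (s : Finset κ)
    (f : κ → V [⋀^ι]→ₗ[R] N) (v : ι → V) : (∑ k ∈ s, f k) v = ∑ k ∈ s, f k v :=
  map_sum ({ toFun := fun g => g v, map_zero' := rfl, map_add' := fun _ _ => rfl } :
    (V [⋀^ι]→ₗ[R] N) →+ N) f s

theorem ofSubsets_apply (U : Finset α) (n : ℕ) (b : α → Finset α → N) (v : α → R)
    (w : Fin n → α → R) :
    ofSubsets R U n b v w = ∑ T ∈ (U.powersetCard n).attach,
      minor R T.1 (Finset.mem_powersetCard.1 T.2).2 w • ∑ x ∈ U, v x • b x T := by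
  simp only [ofSubsets, LinearMap.sum_apply, LinearMap.smulRight_apply, LinearMap.proj_apply,
    finset_sum_apply, AlternatingMap.smul_apply, LinearMap.compAlternatingMap_apply,
    LinearMap.toSpanSingleton_apply, Finset.smul_sum]
  rw [Finset.sum_comm]
  exact Finset.sum_congr rfl fun T _ => Finset.sum_congr rfl fun x _ => smul_comm (v x) _ (b x T)

theorem ofSubsets_single {U : Finset α} {n : ℕ} (b : α → Finset α → N) {x : α} (hx : x ∈ U)
    {T : Finset α} (hT : T ⊆ U) (h : T.card = n) :
    ofSubsets R U n b (Pi.single x 1) (fun j => Pi.single (T.orderEmbOfFin h j) 1) = b x T := by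
  rw [ofSubsets_apply, Finset.sum_eq_single ⟨T, Finset.mem_powersetCard.2 ⟨hT, h⟩⟩]
  · simp [minor_single, Pi.single_apply, hx]
  · rintro T' - hne
    rw [minor_single, if_neg (fun e => hne (Subtype.ext e)), zero_smul]
  · simp

theorem ofSubsets_eq_zero {U : Finset α} {n : ℕ} {b : α → Finset α → N} {v : α → R}
    (h : ∀ T ⊆ U, T.card = n → ∑ x ∈ U, v x • b x T = 0) : ofSubsets R U n b v = 0 := by
  ext w
  rw [ofSubsets_apply]
  refine Finset.sum_eq_zero fun T _ => ?_
  rw [h T (Finset.mem_powersetCard.1 T.2).1 (Finset.mem_powersetCard.1 T.2).2, smul_zero]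

theorem alternatizeUncurryFin_ofSubsets_single {U : Finset α} {n : ℕ} (b : α → Finset α → N)
    {A : Finset α} (hA : A ⊆ U) (h : A.card = n + 1) :
    alternatizeUncurryFin (ofSubsets R U n b) (fun j => Pi.single (A.orderEmbOfFin h j) 1) =
      ∑ x ∈ A, (-1 : R) ^ (A.filter (fun y => y < x)).card • b x (A.erase x) := by
  rw [alternatizeUncurryFin_apply, ← A.sum_orderEmbOfFin h]
  refine Finset.sum_congr rfl fun i _ => ?_
  have hmem := A.orderEmbOfFin_mem h i
  have h' : (A.erase (A.orderEmbOfFin h i)).card = n := by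
    rw [Finset.card_erase_of_mem hmem, h, Nat.add_sub_cancel]
  have hrem : i.removeNth (fun j => (Pi.single (A.orderEmbOfFin h j) 1 : α → R)) =
      fun j => Pi.single ((A.erase (A.orderEmbOfFin h i)).orderEmbOfFin h' j) 1 := by
    ext1 j
    rw [← A.orderEmbOfFin_succAbove h i h' j]
    rfl
  rw [hrem, ofSubsets_single b (hA hmem) ((Finset.erase_subset _ _).trans hA) h',
    A.card_filter_lt_orderEmbOfFin]
  rcases Nat.even_or_odd (i : ℕ) with he | he <;> simp [he.neg_one_pow]

end AlternatingMap

open AlternatingMap in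
/-- If for indices `m ∈ S` outside `L` the values `b m` are linear combinations of the values
`b k` with `k ∈ L`, then the alternating sum over `S` is a linear combination of the alternating
sums over sets that meet `L`. -/
theorem alternatingSum_mem_span {α R N : Type*} [LinearOrder α] [CommRing R] [AddCommGroup N]
    [Module R N] {U L S : Finset α} {n : ℕ} {c : α → α → R} {b : α → Finset α → N}
    (hL : L ⊆ U) (hS : S ⊆ U) (hcard : S.card = n + 1) (hSL : Disjoint S L)
    (hb : ∀ m ∈ S, ∀ T ⊆ U, T.card = n → b m T = ∑ k ∈ L, c m k • b k T) :
    ∑ x ∈ S, (-1 : R) ^ (S.filter (fun y => y < x)).card • b x (S.erase x) ∈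
      Submodule.span R ((fun A : Finset α =>
        ∑ x ∈ A, (-1 : R) ^ (A.filter (fun y => y < x)).card • b x (A.erase x)) ''
          ((U.powersetCard (n + 1)).filter (fun A => (A ∩ L).Nonempty) : Set (Finset α))) := by
  set P := Submodule.span R ((fun A : Finset α =>
        ∑ x ∈ A, (-1 : R) ^ (A.filter (fun y => y < x)).card • b x (A.erase x)) ''
          ((U.powersetCard (n + 1)).filter (fun A => (A ∩ L).Nonempty) : Set (Finset α)))
  set G := alternatizeUncurryFin (ofSubsets R U n b)
  have hG : ∀ r : Fin (n + 1) → α, (∀ i, r i ∈ U) → (∃ i, r i ∈ L) →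
      G (fun j => Pi.single (r j) 1) ∈ P := by
    rintro r hU ⟨i, hi⟩
    by_cases hr : Function.Injective r
    · have hc : (Finset.univ.image r).card = n + 1 := by
        rw [Finset.card_image_of_injective _ hr, Finset.card_fin]
      have himg : Finset.univ.image r ⊆ U := Finset.image_subset_iff.2 fun j _ => hU j
      obtain ⟨σ, hσ⟩ := Finset.exists_perm_orderEmbOfFin_image hr hc
      have hperm := G.map_perm
        (fun j => Pi.single ((Finset.univ.image r).orderEmbOfFin hc j) 1) σ
      have hfun : (fun j => (Pi.single ((Finset.univ.image r).orderEmbOfFin hc j) 1 : α → R)) ∘ σ =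
          fun j => Pi.single (r j) 1 := by
        funext j
        simp only [Function.comp_apply, ← hσ j]
      rw [hfun, alternatizeUncurryFin_ofSubsets_single b himg hc] at hperm
      rw [hperm, Units.smul_def]
      refine P.toAddSubgroup.zsmul_mem (Submodule.subset_span ⟨_, ?_, rfl⟩) _
      simp only [Finset.coe_filter, Set.mem_ofPred_eq, Finset.mem_powersetCard]
      exact ⟨⟨himg, hc⟩, r i, Finset.mem_inter.2 ⟨Finset.mem_image_of_mem r (Finset.mem_univ i), hi⟩⟩
    · obtain ⟨i, j, hij, hne⟩ := Function.not_injective_iff.1 hr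
      rw [G.map_eq_zero_of_eq _ (by simp only [hij]) hne]
      exact P.zero_mem
  set s := S.orderEmbOfFin hcard
  have hsS : ∀ j, s j ∈ S := S.orderEmbOfFin_mem hcard
  let a : Fin (n + 1) → α → R := fun j x => if x ∈ L then - c (s j) x else if x = s j then 1 else 0
  have hker : ∀ j, ofSubsets R U n b (∑ x ∈ U, a j x • Pi.single x 1) = 0 := by
    intro j
    refine ofSubsets_eq_zero fun T hT hTc => ?_
    have hcoord : ∀ x ∈ U, (∑ y ∈ U, a j y • (Pi.single y 1 : α → R)) x = a j x := by
      intro x hx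
      simp [Pi.single_apply, hx]
    rw [Finset.sum_congr rfl fun x hx => by rw [hcoord x hx], ← Finset.sum_sdiff hL]
    have h1 : ∑ x ∈ L, a j x • b x T = - b (s j) T := by
      rw [hb _ (hsS j) T hT hTc, ← Finset.sum_neg_distrib]
      exact Finset.sum_congr rfl fun x hx => by simp [a, hx]
    have h2 : ∑ x ∈ U \ L, a j x • b x T = b (s j) T := by
      have hsj : s j ∈ U \ L :=
        Finset.mem_sdiff.2 ⟨hS (hsS j), Finset.disjoint_left.1 hSL (hsS j)⟩
      rw [Finset.sum_eq_single_of_mem _ hsj]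
      · simp [a, (Finset.mem_sdiff.1 hsj).2]
      · intro x hx hne
        simp [a, (Finset.mem_sdiff.1 hx).2, hne]
    rw [h1, h2, add_neg_cancel]
  have hzero : G (fun j => ∑ x ∈ U, a j x • Pi.single x 1) = 0 := by
    rw [alternatizeUncurryFin_apply]
    exact Finset.sum_eq_zero fun i _ => by rw [hker i]; simp
  have hexp : ∑ r ∈ Fintype.piFinset fun _ : Fin (n + 1) => U,
      (∏ j, a j (r j)) • G (fun j => Pi.single (r j) 1) = 0 := by
    rw [← hzero]
    refine Eq.trans ?_ (G.toMultilinearMap.map_sum_finset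
      (fun j x => a j x • (Pi.single x 1 : α → R)) fun _ => U).symm
    exact Finset.sum_congr rfl fun r _ => (G.map_smul_univ _ _).symm
  have hs : (s : Fin (n + 1) → α) ∈ Fintype.piFinset fun _ : Fin (n + 1) => U :=
    Fintype.mem_piFinset.2 fun j => hS (hsS j)
  rw [← Finset.add_sum_erase _ _ hs] at hexp
  have hone : ∏ j, a j (s j) = 1 :=
    Finset.prod_eq_one fun j _ => by simp [a, Finset.disjoint_left.1 hSL (hsS j)]
  rw [hone, one_smul, alternatizeUncurryFin_ofSubsets_single b hS hcard] at hexp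
  rw [eq_neg_of_add_eq_zero_left hexp]
  refine P.neg_mem (P.sum_mem fun r hr => ?_)
  obtain ⟨hne, hrU⟩ := Finset.mem_erase.1 hr
  by_cases hrL : ∃ i, r i ∈ L
  · exact P.smul_mem _ (hG r (Fintype.mem_piFinset.1 hrU) hrL)
  · push Not at hrL
    obtain ⟨j, hj⟩ := Function.ne_iff.1 hne
    rw [Finset.prod_eq_zero (Finset.mem_univ j) (by simp [a, hrL j, hj]), zero_smul]
    exact P.zero_mem

/-- The sign of an increasing tuple with `p` leaders which turns the structure-plus signs into
those of a single alternating sum. -/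
def leaderSign (R : Type*) [Ring R] (p : ℕ) : R := (-1) ^ (p * (p + 1) / 2)

theorem leaderSign_succ (R : Type*) [Ring R] (p : ℕ) :
    leaderSign R (p + 1) = (-1) ^ (p + 1) * leaderSign R p := by
  rw [leaderSign, leaderSign, ← pow_add]
  congr 1
  have : (p + 1) * (p + 1 + 1) = p * (p + 1) + (p + 1) * 2 := by ring
  rw [this, Nat.add_mul_div_right _ _ two_pos, add_comm]

/-- For leaders preceding all non-leaders, the structure-plus query is, up to a sign, a single
alternating sum. -/
theorem alternatingSum_eq_structurePlusQuery {F : Type*} [Field F] {M K : ℕ}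
    (B : ℕ → Finset ℕ → F) {A : Finset ℕ} (hA : A ⊆ Finset.Icc 1 M) :
    ∑ x ∈ A, (-1 : F) ^ (A.filter (fun y => y < x)).card *
        (leaderSign F ((A.erase x) ∩ Finset.Icc 1 K).card * B x (A.erase x)) =
      (-1) ^ (A ∩ Finset.Icc 1 K).card * leaderSign F (A ∩ Finset.Icc 1 K).card *
        structurePlusQuery K B A := by
  rw [structurePlusQuery, mul_add, Finset.mul_sum, Finset.mul_sum,
    ← Finset.sum_inter_add_sum_sdiff A (Finset.Icc 1 K)]
  congr 1
  · refine Finset.sum_congr rfl fun x hx => ?_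
    obtain ⟨hxA, hxK⟩ := Finset.mem_inter.1 hx
    have h1 : A.filter (fun y => y < x) = (A ∩ Finset.Icc 1 K).filter (fun y => y < x) := by
      ext y
      simp only [Finset.mem_filter, Finset.mem_inter, Finset.mem_Icc] at hxK ⊢
      constructor
      · rintro ⟨hy, hlt⟩
        have := Finset.mem_Icc.1 (hA hy)
        exact ⟨⟨hy, this.1, by omega⟩, hlt⟩
      · rintro ⟨⟨hy, -⟩, hlt⟩
        exact ⟨hy, hlt⟩
    have h2 : (A ∩ Finset.Icc 1 K).card = ((A.erase x) ∩ Finset.Icc 1 K).card + 1 := by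
      rw [Finset.erase_inter, Finset.card_erase_add_one hx]
    have h3 (q : ℕ) : (-1 : F) ^ q * (-1) ^ q = 1 := by rw [← mul_pow]; simp
    rw [h1, h2, leaderSign_succ, ← mul_assoc ((-1 : F) ^ (_ + 1)), h3]
    ring
  · refine Finset.sum_congr rfl fun x hx => ?_
    obtain ⟨hxA, hxK⟩ := Finset.mem_sdiff.1 hx
    have hx1 := Finset.mem_Icc.1 (hA hxA)
    have h1 : (A.filter (fun y => y < x)).card = (A ∩ Finset.Icc 1 K).card +
        ((A \ Finset.Icc 1 K).filter (fun y => y < x)).card := by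
      rw [← Finset.card_inter_add_card_sdiff (A.filter (fun y => y < x)) (Finset.Icc 1 K)]
      congr 2
      · ext y
        simp only [Finset.mem_filter, Finset.mem_inter, Finset.mem_Icc] at hxK ⊢
        constructor
        · rintro ⟨⟨hy, -⟩, h⟩
          exact ⟨hy, h⟩
        · rintro ⟨hy, h⟩
          exact ⟨⟨hy, by omega⟩, h⟩
      · ext y
        simp only [Finset.mem_filter, Finset.mem_sdiff]
        tauto
    have h2 : (A.erase x) ∩ Finset.Icc 1 K = A ∩ Finset.Icc 1 K := by
      rw [Finset.erase_inter, Finset.erase_eq_of_notMem fun h => hxK (Finset.mem_inter.1 h).2]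
    rw [h1, h2, pow_add]
    ring

/-- Redundancy lemma, structure-plus version: every round-`(t+1)` query whose
message set `S` contains no independent (leader) message is a linear
combination of the queries whose message sets intersect the leaders, with
coefficients `β` independent of the actual message values `B`. -/
theorem stmt_5 (F : Type*) [Field F] (M K t : ℕ) (hK1 : 1 ≤ K) (hKM : K ≤ M)
    (htM : t + 1 ≤ M) (c : ℕ → ℕ → F) (S : Finset ℕ) (hS : S ⊆ Finset.Icc 1 M)
    (hScard : S.card = t + 1) (hSleaders : S ∩ Finset.Icc 1 K = ∅) :
    ∃ β : Finset ℕ → F, ∀ B : ℕ → Finset ℕ → F,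
      (∀ m ∈ Finset.Icc (K + 1) M, ∀ T ⊆ Finset.Icc 1 M, T.card = t →
        B m T = ∑ k ∈ Finset.Icc 1 K, c m k * B k T) →
      structurePlusQuery K B S =
        ∑ A ∈ ((Finset.Icc 1 M).powersetCard (t + 1)).filter
            (fun A => (A ∩ Finset.Icc 1 K).Nonempty),
          β A * structurePlusQuery K B A := by
  let C := {B : ℕ → Finset ℕ → F // ∀ m ∈ Finset.Icc (K + 1) M, ∀ T ⊆ Finset.Icc 1 M,
    T.card = t → B m T = ∑ k ∈ Finset.Icc 1 K, c m k * B k T}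
  let b : ℕ → Finset ℕ → C → F := fun x T B =>
    leaderSign F (T ∩ Finset.Icc 1 K).card * B.1 x T
  have hLU : Finset.Icc 1 K ⊆ Finset.Icc 1 M := Finset.Icc_subset_Icc_right hKM
  have hdisj : Disjoint S (Finset.Icc 1 K) := Finset.disjoint_iff_inter_eq_empty.2 hSleaders
  have hb : ∀ m ∈ S, ∀ T ⊆ Finset.Icc 1 M, T.card = t →
      b m T = ∑ k ∈ Finset.Icc 1 K, c m k • b k T := by
    intro m hm T hT hTc
    have hmM := Finset.mem_Icc.1 (hS hm)
    have hmK := Finset.disjoint_left.1 hdisj hm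
    rw [Finset.mem_Icc] at hmK
    funext B
    simp only [b, Finset.sum_apply, Pi.smul_apply, smul_eq_mul]
    rw [B.2 m (Finset.mem_Icc.2 (by omega)) T hT hTc, Finset.mul_sum]
    exact Finset.sum_congr rfl fun k _ => mul_left_comm _ _ _
  have hspan := alternatingSum_mem_span hLU hS hScard hdisj hb
  obtain ⟨γ, hγ⟩ := (Submodule.mem_span_image_finset_iff_exists_fun' F).1 hspan
  refine ⟨fun A => γ A * ((-1) ^ (A ∩ Finset.Icc 1 K).card *
    leaderSign F (A ∩ Finset.Icc 1 K).card), fun B hB => ?_⟩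
  have hB' := congrFun hγ ⟨B, hB⟩
  simp only [b, Finset.sum_apply, Pi.smul_apply, smul_eq_mul] at hB'
  rw [alternatingSum_eq_structurePlusQuery B hS, hSleaders] at hB'
  simp only [Finset.card_empty, leaderSign, pow_zero, zero_mul, Nat.zero_div, one_mul] at hB'
  rw [← hB']
  refine Finset.sum_congr rfl fun A hA => ?_
  have hAM := (Finset.mem_powersetCard.1 (Finset.mem_filter.1 hA).1).1
  have := alternatingSum_eq_structurePlusQuery (K := K) B hAM
  simp only [leaderSign] at this ⊢
  rw [this]
  ring
end

section
/- Let N, P, K be integers with N ≥ 2 and 1 ≤ P ≤ K. Define the real numbers C = (1 − 1/N)/(1 − (1/N)^K), and U = (1 − 1/N)/(1 − (1/N)^{⌊K/P⌋}) if 2P ≤ K, while U = P·N/(P·N + K − P) if 2P > K. Then U ≤ 2·C. -/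
/-- A positive integer power of `x ∈ [0, 1]` is at most `x`. -/
theorem zpow_le_self_of_le_one {x : ℝ} (h0 : 0 ≤ x) (h1 : x ≤ 1) {m : ℤ} (hm : 1 ≤ m) :
    x ^ m ≤ x := by
  lift m to ℕ using by omega
  rw [zpow_natCast]
  exact pow_le_of_le_one h0 h1 (by omega)

/-- Theorem 2 of the MM-PC paper (order-optimality of the baseline scheme):
the MM-PIR upper bound `U` on the optimal MM-PC rate is at most twice the
baseline rate `C = (1 - 1/N)/(1 - (1/N)^K)`, where
`U = (1 - 1/N)/(1 - (1/N)^⌊K/P⌋)` when `2P ≤ K` and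
`U = PN/(PN + K - P)` when `2P > K`.  Here `K / P` is integer (floor)
division. -/
theorem stmt_7 (N P K : ℤ) (hN : 2 ≤ N) (hP : 1 ≤ P) (hPK : P ≤ K) :
    (if 2 * P ≤ K then
        (1 - 1 / (N : ℝ)) / (1 - (1 / (N : ℝ)) ^ (K / P))
      else
        (P : ℝ) * (N : ℝ) / ((P : ℝ) * (N : ℝ) + (K : ℝ) - (P : ℝ))) ≤
      2 * ((1 - 1 / (N : ℝ)) / (1 - (1 / (N : ℝ)) ^ K)) := by
  have hN' : (2 : ℝ) ≤ N := by exact_mod_cast hN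
  have hP' : (1 : ℝ) ≤ P := by exact_mod_cast hP
  have hPK' : (P : ℝ) ≤ K := by exact_mod_cast hPK
  have hx0 : 0 < 1 / (N : ℝ) := by positivity
  have hx : 1 / (N : ℝ) ≤ 1 / 2 := by gcongr
  have hPN : 0 < (P : ℝ) * N := by positivity
  generalize 1 / (N : ℝ) = x at hx0 hx ⊢
  have hpow {m : ℤ} (hm : 1 ≤ m) : x ^ m ≤ 1 / 2 :=
    (zpow_le_self_of_le_one hx0.le (by linarith) hm).trans hx
  have hC : 1 - x ≤ (1 - x) / (1 - x ^ K) := by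
    have hK := hpow (hP.trans hPK)
    have hK0 : 0 < x ^ K := zpow_pos hx0 K
    exact le_div_self (by linarith) (by linarith) (by linarith)
  refine le_trans ?_ (mul_le_mul_of_nonneg_left hC zero_le_two)
  split_ifs with h
  · have hm := hpow ((Int.le_ediv_iff_mul_le (by omega)).mpr (by omega) : 1 ≤ K / P)
    rw [div_le_iff₀ (by linarith)]
    nlinarith
  · have hU : (P : ℝ) * N / (P * N + K - P) ≤ 1 :=
      div_le_one_of_le₀ (by linarith) (by linarith)
    linarith
end
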